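/- Assume 0 < a₁ < a₂ < a₃ < a₄ < a₅ < 1, and that m is strictly increasing on [0,a₁], on [a₂,a₃], and on [a₅,1]; m is strictly decreasing on [a₁,a₂] and on [a₄,a₅]; and m is constant on [a₃,a₄]. Then lim_{s→∞} λ₁ᴺ(s) = min{ c(a₁), c(1), λ₁^{NN}(a₃,a₄) }. -/

import Mathlib

open MeasureTheory Filter Set

/-- The Neumann principal eigenvalue of `-φ'' - 2 s m' φ' + c φ = λ φ` on `(0,1)`,
via its variational characterization. -/
noncomputable def lambdaN (m c : ℝ → ℝ) (s : ℝ) : ℝ :=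
  sInf {l : ℝ | ∃ φ : ℝ → ℝ, ContDiff ℝ 1 φ ∧
    (∫ x in (0:ℝ)..1, Real.exp (2 * s * m x) * (φ x) ^ 2) = 1 ∧
    l = ∫ x in (0:ℝ)..1, Real.exp (2 * s * m x) * ((deriv φ x) ^ 2 + c x * (φ x) ^ 2)}

/-- The principal eigenvalue of `-φ'' + c φ = λ φ` on `(a,b)`, with a Dirichlet
condition at `a` iff `dirA = true` and at `b` iff `dirB = true`
(Neumann, i.e. no constraint, otherwise), via its variational characterization. -/
noncomputable def lambdaIJ (c : ℝ → ℝ) (dirA dirB : Bool) (a b : ℝ) : ℝ :=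
  sInf {l : ℝ | ∃ φ : ℝ → ℝ, ContDiff ℝ 1 φ ∧
    (dirA = true → φ a = 0) ∧ (dirB = true → φ b = 0) ∧
    (∫ x in a..b, (φ x) ^ 2) = 1 ∧
    l = ∫ x in a..b, ((deriv φ x) ^ 2 + c x * (φ x) ^ 2)}

theorem sq_intervalIntegral_le {f : ℝ → ℝ} (hf : Continuous f) {a b : ℝ} (hab : a ≤ b) :
    (∫ x in a..b, f x) ^ 2 ≤ (b - a) * ∫ x in a..b, f x ^ 2 := by
  rcases hab.eq_or_lt with rfl | hlt
  · simp
  set A := ∫ x in a..b, f x with hA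
  have h0 : 0 ≤ ∫ x in a..b, ((b - a) * f x - A) ^ 2 :=
    intervalIntegral.integral_nonneg hab fun x _ => sq_nonneg _
  have h1 : ∫ x in a..b, ((b - a) * f x - A) ^ 2
      = (b - a) * ((b - a) * (∫ x in a..b, f x ^ 2) - A ^ 2) := by
    have : ∀ x, ((b - a) * f x - A) ^ 2
        = (b - a) ^ 2 * f x ^ 2 - 2 * (b - a) * A * f x + A ^ 2 := fun x => by ring
    simp_rw [this]
    rw [intervalIntegral.integral_add, intervalIntegral.integral_sub,
      intervalIntegral.integral_const_mul, intervalIntegral.integral_const_mul,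
      intervalIntegral.integral_const, ← hA]
    · simp only [smul_eq_mul]; ring
    all_goals exact Continuous.intervalIntegrable (by fun_prop) _ _
  rw [h1] at h0
  linarith [nonneg_of_mul_nonneg_right h0 (sub_pos.2 hlt)]

/-- Weighted pointwise bound: a value of `φ` is controlled by the weighted energy on an interval
on which the weight is at least as large as at the point. -/
theorem weighted_sq_le {m φ : ℝ → ℝ} (hm : Continuous m) (hφ : ContDiff ℝ 1 φ)
    {s η p q u v x : ℝ} (hs : 0 ≤ s) (hp : 0 ≤ p) (hq : q ≤ 1) (hpu : p ≤ u) (huv : u < v)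
    (hvq : v ≤ q) (hx : x ∈ Icc p q) (hmt : ∀ t ∈ Icc p q, m x ≤ m t)
    (hmη : ∀ t ∈ Icc u v, m x + η ≤ m t) :
    Real.exp (2 * s * m x) * φ x ^ 2 ≤
      2 / (v - u) * Real.exp (-(2 * s * η)) * (∫ t in (0:ℝ)..1, Real.exp (2 * s * m t) * φ t ^ 2)
        + 2 * (q - p) * ∫ t in (0:ℝ)..1, Real.exp (2 * s * m t) * deriv φ t ^ 2 := by
  have hd : Continuous (deriv φ) := hφ.continuous_deriv le_rfl
  have hc := hφ.continuous
  have hpq : p ≤ q := hx.1.trans hx.2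
  set P := ∫ t in (0:ℝ)..1, Real.exp (2 * s * m t) * deriv φ t ^ 2 with hP
  set W := ∫ t in (0:ℝ)..1, Real.exp (2 * s * m t) * φ t ^ 2 with hW
  have hmono : ∀ f : ℝ → ℝ, Continuous f → ∀ a b, 0 ≤ a → a ≤ b → b ≤ 1 →
      ∫ t in a..b, Real.exp (2 * s * m t) * f t ^ 2
        ≤ ∫ t in (0:ℝ)..1, Real.exp (2 * s * m t) * f t ^ 2 := by
    intro f hf a b ha hab hb
    refine intervalIntegral.integral_mono_interval ha hab hb ?_ ?_
    · exact Eventually.of_forall fun t => by positivity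
    · exact Continuous.intervalIntegrable (by fun_prop) _ _
  have hdiff : ∀ y ∈ Icc p q,
      Real.exp (2 * s * m x) * (φ x - φ y) ^ 2 ≤ (q - p) * P := by
    intro y hy
    have h1 : (φ x - φ y) ^ 2 ≤ (q - p) * ∫ t in p..q, deriv φ t ^ 2 := by
      have key : ∀ a ∈ Icc p q, ∀ b ∈ Icc p q, a ≤ b →
          (φ b - φ a) ^ 2 ≤ (q - p) * ∫ t in p..q, deriv φ t ^ 2 := by
        intro a ha b hb hab
        rw [← intervalIntegral.integral_deriv_eq_sub
          (fun t _ => (hφ.differentiable one_ne_zero).differentiableAt)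
          (hd.intervalIntegrable _ _)]
        refine (sq_intervalIntegral_le hd hab).trans ?_
        refine mul_le_mul (by linarith [ha.1, hb.2]) ?_ ?_ (by linarith)
        · refine intervalIntegral.integral_mono_interval ha.1 hab hb.2 ?_ ?_
          · exact Eventually.of_forall fun t => by positivity
          · exact Continuous.intervalIntegrable (by fun_prop) _ _
        · exact intervalIntegral.integral_nonneg hab fun _ _ => sq_nonneg _
      rcases le_total x y with h | h
      · have := key x hx y hy h
        rwa [← neg_sub, neg_sq] at this
      · exact key y hy x hx h
    have h2 : Real.exp (2 * s * m x) * ∫ t in p..q, deriv φ t ^ 2 ≤ P := by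
      refine le_trans ?_ (hmono _ hd p q hp hpq hq)
      rw [← intervalIntegral.integral_const_mul]
      refine intervalIntegral.integral_mono_on hpq ?_ ?_ ?_
      · exact Continuous.intervalIntegrable (by fun_prop) _ _
      · exact Continuous.intervalIntegrable (by fun_prop) _ _
      · intro t ht
        have := hmt t ht
        gcongr
    calc _ ≤ Real.exp (2 * s * m x) * ((q - p) * ∫ t in p..q, deriv φ t ^ 2) := by gcongr
      _ = (q - p) * (Real.exp (2 * s * m x) * ∫ t in p..q, deriv φ t ^ 2) := by ring
      _ ≤ _ := mul_le_mul_of_nonneg_left h2 (by linarith)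
  have hpt : ∀ y ∈ Icc u v, Real.exp (2 * s * m x) * φ x ^ 2 ≤
      2 * Real.exp (-(2 * s * η)) * (Real.exp (2 * s * m y) * φ y ^ 2)
        + 2 * (q - p) * P := by
    intro y hy
    have h1 := hdiff y ⟨hpu.trans hy.1, hy.2.trans hvq⟩
    have h2 : Real.exp (2 * s * m x) ≤ Real.exp (-(2 * s * η)) * Real.exp (2 * s * m y) := by
      rw [← Real.exp_add]
      have := mul_le_mul_of_nonneg_left (hmη y hy) (by linarith : 0 ≤ 2 * s)
      gcongr
      linarith
    have h3 : φ x ^ 2 ≤ 2 * φ y ^ 2 + 2 * (φ x - φ y) ^ 2 := by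
      nlinarith [sq_nonneg (φ x - 2 * φ y)]
    have h4 := mul_le_mul_of_nonneg_left h3 (Real.exp_pos (2 * s * m x)).le
    have h5 := mul_le_mul_of_nonneg_right h2 (sq_nonneg (φ y))
    nlinarith
  have hint := intervalIntegral.integral_mono_on (μ := volume) huv.le
    (f := fun _ => Real.exp (2 * s * m x) * φ x ^ 2)
    (continuous_const.intervalIntegrable _ _)
    (Continuous.intervalIntegrable (by fun_prop) _ _) hpt
  rw [intervalIntegral.integral_const, intervalIntegral.integral_add
    (Continuous.intervalIntegrable (by fun_prop) _ _) (continuous_const.intervalIntegrable _ _),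
    intervalIntegral.integral_const, intervalIntegral.integral_const_mul] at hint
  simp only [smul_eq_mul] at hint
  have hle := hmono φ hc u v (hp.trans hpu) huv.le (hvq.trans hq)
  have hvu : 0 < v - u := sub_pos.2 huv
  have h6 : (v - u) * (Real.exp (2 * s * m x) * φ x ^ 2) ≤
      2 * Real.exp (-(2 * s * η)) * W + (v - u) * (2 * (q - p) * P) :=
    hint.trans (by gcongr)
  rw [← mul_le_mul_iff_right₀ hvu]
  refine h6.trans (le_of_eq ?_)
  field_simp

/-- Mass of energy-bounded functions vanishes, uniformly away from the right end of an interval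
on which the exponent increases. -/
theorem decay_of_strictMonoOn {m : ℝ → ℝ} (hm : Continuous m) {a b δ B ε : ℝ} (ha : 0 ≤ a)
    (hb : b ≤ 1) (hmono : StrictMonoOn m (Icc a b)) (hδ : 0 < δ) (hB : 0 ≤ B) (hε : 0 < ε) :
    ∀ᶠ s in atTop, ∀ φ : ℝ → ℝ, ContDiff ℝ 1 φ →
      (∫ t in (0:ℝ)..1, Real.exp (2 * s * m t) * φ t ^ 2) = 1 →
      (∫ t in (0:ℝ)..1, Real.exp (2 * s * m t) * deriv φ t ^ 2) ≤ B →
      ∀ x ∈ Icc a (b - δ), Real.exp (2 * s * m x) * φ x ^ 2 ≤ ε := by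
  rcases (Icc a (b - δ)).eq_empty_or_nonempty with he | hne
  · simp [he]
  obtain ⟨h, hh, hhδ, hhB⟩ : ∃ h : ℝ, 0 < h ∧ 2 * h ≤ δ ∧ 4 * h * B ≤ ε / 2 := by
    refine ⟨min (δ / 2) (ε / (8 * (B + 1))), by positivity, ?_, ?_⟩
    · linarith [min_le_left (δ / 2) (ε / (8 * (B + 1)))]
    · have h1 := min_le_right (δ / 2) (ε / (8 * (B + 1)))
      rw [le_div_iff₀ (by positivity)] at h1
      have h2 : 0 < min (δ / 2) (ε / (8 * (B + 1))) := by positivity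
      nlinarith
  obtain ⟨x₀, hx₀, hmin⟩ := isCompact_Icc.exists_isMinOn hne
    (f := fun x => m (x + h) - m x) (by fun_prop)
  set η := m (x₀ + h) - m x₀ with hηdef
  have hη : 0 < η := by
    refine sub_pos.2 (hmono ⟨hx₀.1, by linarith [hx₀.2]⟩ ⟨?_, ?_⟩ ?_) <;> linarith [hx₀.1, hx₀.2]
  have hlim : Tendsto (fun s : ℝ => 2 / h * Real.exp (-(2 * s * η))) atTop (nhds (2 / h * 0)) := by
    refine Tendsto.const_mul _ (Real.tendsto_exp_neg_atTop_nhds_zero.comp ?_)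
    exact (tendsto_id.const_mul_atTop two_pos).atTop_mul_const hη
  rw [mul_zero] at hlim
  filter_upwards [hlim.eventually (ge_mem_nhds (half_pos hε)), eventually_ge_atTop 0]
    with s hs hs0 φ hφ hW hP x hx
  have key := weighted_sq_le (s := s) (η := η) (p := x) (q := x + 2 * h) (u := x + h)
    (v := x + 2 * h) (x := x) hm hφ hs0 (ha.trans hx.1) (by linarith [hx.2]) (by linarith)
    (by linarith) le_rfl ⟨le_rfl, by linarith⟩
    (fun t ht => hmono.monotoneOn ⟨hx.1, by linarith [hx.2]⟩
      ⟨hx.1.trans ht.1, by linarith [ht.2, hx.2]⟩ ht.1)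
    (fun t ht => by
      have h1 : η ≤ m (x + h) - m x := hmin hx
      have h2 : m (x + h) ≤ m t := hmono.monotoneOn ⟨by linarith [hx.1], by linarith [hx.2]⟩
        ⟨by linarith [hx.1, ht.1], by linarith [ht.2, hx.2]⟩ ht.1
      linarith)
  rw [hW] at key
  have e1 : x + 2 * h - (x + h) = h := by ring
  have e2 : 2 * (x + 2 * h - x) = 4 * h := by ring
  rw [e1, e2] at key
  have := mul_le_mul_of_nonneg_left hP (by linarith : 0 ≤ 4 * h)
  linarith

theorem decay_of_strictAntiOn {m : ℝ → ℝ} (hm : Continuous m) {a b δ B ε : ℝ} (ha : 0 ≤ a)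
    (hb : b ≤ 1) (hanti : StrictAntiOn m (Icc a b)) (hδ : 0 < δ) (hB : 0 ≤ B) (hε : 0 < ε) :
    ∀ᶠ s in atTop, ∀ φ : ℝ → ℝ, ContDiff ℝ 1 φ →
      (∫ t in (0:ℝ)..1, Real.exp (2 * s * m t) * φ t ^ 2) = 1 →
      (∫ t in (0:ℝ)..1, Real.exp (2 * s * m t) * deriv φ t ^ 2) ≤ B →
      ∀ x ∈ Icc (a + δ) b, Real.exp (2 * s * m x) * φ x ^ 2 ≤ ε := by
  have hmono : StrictMonoOn (fun x => m (1 - x)) (Icc (1 - b) (1 - a)) := by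
    intro x hx y hy hxy
    exact hanti ⟨by linarith [hy.2], by linarith [hy.1]⟩ ⟨by linarith [hx.2], by linarith [hx.1]⟩
      (by linarith)
  have hcont : Continuous fun x => m (1 - x) := by fun_prop
  filter_upwards [decay_of_strictMonoOn hcont (sub_nonneg.2 hb) (by linarith) hmono
    hδ hB hε] with s hs φ hφ hW hP x hx
  have hreflect : ∀ g : ℝ → ℝ, ∫ t in (0:ℝ)..1, g (1 - t) = ∫ t in (0:ℝ)..1, g t := by
    intro g
    simp
  have := hs (fun t => φ (1 - t)) (hφ.comp (contDiff_const.sub contDiff_id))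
    ((hreflect fun t => Real.exp (2 * s * m t) * φ t ^ 2).trans hW)
    (by
      have h1 : ∀ t, deriv (fun t => φ (1 - t)) t = -deriv φ (1 - t) := fun t =>
        deriv_comp_const_sub ..
      simp_rw [h1, neg_sq]
      exact (hreflect fun t => Real.exp (2 * s * m t) * deriv φ t ^ 2).trans_le hP)
    (1 - x) ⟨by linarith [hx.2], by linarith [hx.1]⟩
  simpa using this

theorem exists_normalized {w c φ : ℝ → ℝ} (hφ : ContDiff ℝ 1 φ) {a b : ℝ}
    (hD : 0 < ∫ x in a..b, w x * φ x ^ 2) :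
    ∃ ψ : ℝ → ℝ, ContDiff ℝ 1 ψ ∧ (∫ x in a..b, w x * ψ x ^ 2) = 1 ∧
      (∫ x in a..b, w x * (deriv ψ x ^ 2 + c x * ψ x ^ 2)) =
        (∫ x in a..b, w x * (deriv φ x ^ 2 + c x * φ x ^ 2)) / ∫ x in a..b, w x * φ x ^ 2 := by
  set D := ∫ x in a..b, w x * φ x ^ 2 with hDdef
  have hr : (Real.sqrt D)⁻¹ ^ 2 = D⁻¹ := by rw [inv_pow, Real.sq_sqrt hD.le]
  refine ⟨fun x => (Real.sqrt D)⁻¹ * φ x, contDiff_const.mul hφ, ?_, ?_⟩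
  · have : ∀ x, w x * ((Real.sqrt D)⁻¹ * φ x) ^ 2 = D⁻¹ * (w x * φ x ^ 2) := fun x => by
      rw [← hr]; ring
    simp_rw [this]
    rw [intervalIntegral.integral_const_mul, ← hDdef, inv_mul_cancel₀ hD.ne']
  · have hd : ∀ x, deriv (fun x => (Real.sqrt D)⁻¹ * φ x) x = (Real.sqrt D)⁻¹ * deriv φ x :=
      fun x => deriv_const_mul _ (hφ.differentiable one_ne_zero).differentiableAt
    have : ∀ x, w x * (deriv (fun x => (Real.sqrt D)⁻¹ * φ x) x ^ 2
        + c x * ((Real.sqrt D)⁻¹ * φ x) ^ 2)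
        = D⁻¹ * (w x * (deriv φ x ^ 2 + c x * φ x ^ 2)) := fun x => by
      rw [hd, ← hr]; ring
    simp_rw [this]
    rw [intervalIntegral.integral_const_mul, div_eq_inv_mul]

theorem neg_mul_le_energy {w c φ : ℝ → ℝ} (hw : Continuous w) (hw0 : ∀ x, 0 ≤ w x)
    (hc : Continuous c) (hφ : ContDiff ℝ 1 φ) {a b K : ℝ} (hab : a ≤ b)
    (hK : ∀ x ∈ Icc a b, |c x| ≤ K) :
    -K * (∫ x in a..b, w x * φ x ^ 2) ≤ ∫ x in a..b, w x * (deriv φ x ^ 2 + c x * φ x ^ 2) := by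
  have hd : Continuous (deriv φ) := hφ.continuous_deriv le_rfl
  have hφc := hφ.continuous
  rw [← intervalIntegral.integral_const_mul]
  refine intervalIntegral.integral_mono_on hab (Continuous.intervalIntegrable (by fun_prop) _ _)
    (Continuous.intervalIntegrable (by fun_prop) _ _) fun x hx => ?_
  have h1 := (abs_le.1 (hK x hx)).1
  have h2 : w x * (-K * φ x ^ 2) ≤ w x * (deriv φ x ^ 2 + c x * φ x ^ 2) := by
    refine mul_le_mul_of_nonneg_left ?_ (hw0 x)
    nlinarith [sq_nonneg (deriv φ x), mul_le_mul_of_nonneg_right h1 (sq_nonneg (φ x))]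
  linarith

theorem exists_abs_le {c : ℝ → ℝ} (hc : Continuous c) (a b : ℝ) :
    ∃ K, ∀ x ∈ Icc a b, |c x| ≤ K :=
  isCompact_Icc.exists_bound_of_continuousOn hc.continuousOn

theorem lambdaN_le_div {m c φ : ℝ → ℝ} (hm : Continuous m) (hc : Continuous c)
    (hφ : ContDiff ℝ 1 φ) {s : ℝ} (hD : 0 < ∫ x in (0:ℝ)..1, Real.exp (2 * s * m x) * φ x ^ 2) :
    lambdaN m c s ≤ (∫ x in (0:ℝ)..1, Real.exp (2 * s * m x) * (deriv φ x ^ 2 + c x * φ x ^ 2))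
      / ∫ x in (0:ℝ)..1, Real.exp (2 * s * m x) * φ x ^ 2 := by
  obtain ⟨K, hK⟩ := exists_abs_le hc 0 1
  obtain ⟨ψ, hψ, h1, h2⟩ := exists_normalized (c := c) hφ hD
  refine csInf_le ⟨-K, ?_⟩ ⟨ψ, hψ, h1, h2.symm⟩
  rintro _ ⟨χ, hχ, hχ1, rfl⟩
  have := neg_mul_le_energy (w := fun x => Real.exp (2 * s * m x)) (by fun_prop)
    (fun x => (Real.exp_pos _).le) hc hχ zero_le_one hK
  rwa [hχ1, mul_one] at this

theorem lambdaIJ_mul_le {c φ : ℝ → ℝ} (hc : Continuous c) (hφ : ContDiff ℝ 1 φ) {a b : ℝ}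
    (hab : a ≤ b) :
    lambdaIJ c false false a b * (∫ x in a..b, φ x ^ 2) ≤
      ∫ x in a..b, (deriv φ x ^ 2 + c x * φ x ^ 2) := by
  obtain ⟨K, hK⟩ := exists_abs_le hc a b
  have hlow : ∀ χ : ℝ → ℝ, ContDiff ℝ 1 χ →
      -K * (∫ x in a..b, χ x ^ 2) ≤ ∫ x in a..b, (deriv χ x ^ 2 + c x * χ x ^ 2) := by
    intro χ hχ
    simpa using neg_mul_le_energy (w := fun _ => 1) continuous_const
      (fun _ => zero_le_one) hc hχ hab hK
  have h0 : 0 ≤ ∫ x in a..b, φ x ^ 2 := intervalIntegral.integral_nonneg hab fun _ _ => sq_nonneg _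
  rcases h0.eq_or_lt with h0 | h0
  · simpa [← h0] using hlow φ hφ
  rw [← le_div_iff₀ h0]
  obtain ⟨ψ, hψ, h1, h2⟩ := exists_normalized (w := fun _ => 1) (c := c) (a := a) (b := b) hφ
    (by simpa using h0)
  simp only [one_mul] at h1 h2
  refine csInf_le ⟨-K, ?_⟩ ⟨ψ, hψ, by simp, by simp, h1, h2.symm⟩
  rintro _ ⟨χ, hχ, -, -, hχ1, rfl⟩
  simpa [hχ1] using hlow χ hχ

theorem lambdaIJ_nonempty (c : ℝ → ℝ) {a b : ℝ} (hab : a < b) :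
    {l : ℝ | ∃ φ : ℝ → ℝ, ContDiff ℝ 1 φ ∧
      (false = true → φ a = 0) ∧ (false = true → φ b = 0) ∧
      (∫ x in a..b, (φ x) ^ 2) = 1 ∧
      l = ∫ x in a..b, ((deriv φ x) ^ 2 + c x * (φ x) ^ 2)}.Nonempty := by
  obtain ⟨ψ, hψ, h1, -⟩ := exists_normalized (w := fun _ => 1) (c := c) (a := a) (b := b)
    (φ := fun _ => 1) contDiff_const (by simpa using hab)
  exact ⟨_, ψ, hψ, by simp, by simp, by simpa using h1, rfl⟩

theorem le_lambdaN {m c : ℝ → ℝ} (hm : Continuous m) {s L : ℝ}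
    (h : ∀ φ : ℝ → ℝ, ContDiff ℝ 1 φ →
      (∫ x in (0:ℝ)..1, Real.exp (2 * s * m x) * φ x ^ 2) = 1 →
      L ≤ ∫ x in (0:ℝ)..1, Real.exp (2 * s * m x) * (deriv φ x ^ 2 + c x * φ x ^ 2)) :
    L ≤ lambdaN m c s := by
  refine le_csInf ?_ ?_
  · obtain ⟨ψ, hψ, h1, -⟩ := exists_normalized (w := fun x => Real.exp (2 * s * m x)) (c := c)
      (a := 0) (b := 1) (φ := fun _ => 1) contDiff_const
      (intervalIntegral.intervalIntegral_pos_of_pos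
        (Continuous.intervalIntegrable (by fun_prop) _ _) (fun x => by positivity) one_pos)
    exact ⟨_, ψ, hψ, h1, rfl⟩
  · rintro _ ⟨φ, hφ, h1, rfl⟩
    exact h φ hφ h1

/-- An isolated maximum point `a` of `m` bounds the eigenvalue asymptotically by `c a`. -/
theorem eventually_lambdaN_lt_of_peak {m c : ℝ → ℝ} (hm : Continuous m) (hc : Continuous c)
    {a δ L : ℝ} (ha : a ∈ Icc (0:ℝ) 1) (hδ : 0 < δ)
    (hpeak : ∀ x ∈ Icc (0:ℝ) 1, x ≠ a → |x - a| ≤ δ → m x < m a) (hL : c a < L) :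
    ∀ᶠ s in atTop, lambdaN m c s < L := by
  obtain ⟨L₁, hcL₁, hL₁⟩ := exists_between hL
  obtain ⟨L₂, hL₁₂, hL₂⟩ := exists_between hL₁
  obtain ⟨r, hr, hrδ, hrc⟩ : ∃ r, 0 < r ∧ r ≤ δ ∧ ∀ x, |x - a| ≤ r → c x ≤ L₁ := by
    obtain ⟨r, hr, h⟩ := Metric.eventually_nhds_iff_ball.1
      (hc.continuousAt.eventually (gt_mem_nhds hcL₁ : ∀ᶠ y in nhds (c a), y < L₁))
    refine ⟨min δ (r / 2), by positivity, min_le_left _ _, fun x hx => (h x ?_).le⟩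
    rw [Metric.mem_ball, Real.dist_eq]
    linarith [min_le_right δ (r / 2)]
  let ψ : ContDiffBump a := ⟨r / 2, r, by positivity, by linarith⟩
  have hψ : ContDiff ℝ 1 ψ := ψ.contDiff
  have hψc : Continuous ψ := ψ.continuous
  have hd : Continuous (deriv ψ) := hψ.continuous_deriv le_rfl
  have hψ1 : ∀ x, |x - a| ≤ r / 2 → ψ x = 1 := fun x hx =>
    ψ.one_of_mem_closedBall (by rwa [Metric.mem_closedBall, Real.dist_eq])
  have hψ0 : ∀ x, r ≤ |x - a| → ψ x = 0 := fun x hx =>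
    ψ.zero_of_le_dist (by rwa [Real.dist_eq])
  have hopen : Continuous fun x : ℝ => |x - a| := by fun_prop
  have hd1 : ∀ x, |x - a| < r / 2 → deriv ψ x = 0 := fun x hx => by
    have : (ψ : ℝ → ℝ) =ᶠ[nhds x] fun _ => 1 := by
      filter_upwards [(isOpen_lt hopen continuous_const).mem_nhds hx] with y hy
      exact hψ1 y (le_of_lt hy)
    rw [this.deriv_eq, deriv_const]
  have hd0 : ∀ x, r < |x - a| → deriv ψ x = 0 := fun x hx => by
    have : (ψ : ℝ → ℝ) =ᶠ[nhds x] fun _ => 0 := by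
      filter_upwards [(isOpen_lt continuous_const hopen).mem_nhds hx] with y hy
      exact hψ0 y (le_of_lt hy)
    rw [this.deriv_eq, deriv_const]
  obtain ⟨θ, hθ, hmθ⟩ : ∃ θ < m a, ∀ x ∈ Icc (0:ℝ) 1, r / 2 ≤ |x - a| → |x - a| ≤ r → m x ≤ θ := by
    have hA : IsCompact (Icc (0:ℝ) 1 ∩ {x | r / 2 ≤ |x - a| ∧ |x - a| ≤ r}) :=
      isCompact_Icc.inter_right ((isClosed_le continuous_const hopen).inter
        (isClosed_le hopen continuous_const))
    rcases (Icc (0:ℝ) 1 ∩ {x | r / 2 ≤ |x - a| ∧ |x - a| ≤ r}).eq_empty_or_nonempty with he | hne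
    · refine ⟨m a - 1, by linarith, fun x hx h1 h2 => ?_⟩
      exact absurd (show x ∈ Icc (0:ℝ) 1 ∩ {x | r / 2 ≤ |x - a| ∧ |x - a| ≤ r} from ⟨hx, h1, h2⟩) (he ▸ notMem_empty x)
    · obtain ⟨y, hy, hmax⟩ := hA.exists_isMaxOn hne hm.continuousOn
      refine ⟨m y, hpeak y hy.1 ?_ (hy.2.2.trans hrδ), fun x hx h1 h2 => hmax ⟨hx, h1, h2⟩⟩
      rintro rfl
      have := hy.2.1
      rw [sub_self, abs_zero] at this
      linarith
  obtain ⟨θ', hθθ', hθ'⟩ := exists_between hθ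
  obtain ⟨ρ, hρ, hρr, hmρ⟩ : ∃ ρ, 0 < ρ ∧ ρ ≤ r / 2 ∧ ∀ x, |x - a| ≤ ρ → θ' ≤ m x := by
    obtain ⟨ρ, hρ, h⟩ := Metric.eventually_nhds_iff_ball.1
      (hm.continuousAt.eventually (lt_mem_nhds hθ' : ∀ᶠ y in nhds (m a), θ' < y))
    refine ⟨min (r / 2) (ρ / 2), by positivity, min_le_left _ _, fun x hx => (h x ?_).le⟩
    rw [Metric.mem_ball, Real.dist_eq]
    linarith [min_le_right (r / 2) (ρ / 2)]
  obtain ⟨u, v, hu, huv, hv, hau, hva⟩ : ∃ u v : ℝ, 0 ≤ u ∧ u < v ∧ v ≤ 1 ∧ a - ρ ≤ u ∧ v ≤ a + ρ :=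
    ⟨max 0 (a - ρ), min 1 (a + ρ), le_max_left _ _,
      max_lt (lt_min one_pos (by linarith [ha.1])) (lt_min (by linarith [ha.2]) (by linarith)),
      min_le_left _ _, le_max_right _ _, min_le_right _ _⟩
  obtain ⟨D₀, hD₀⟩ := exists_abs_le (hd.pow 2) 0 1
  have hlim : Tendsto (fun s : ℝ => (L₂ - L₁) * (v - u) * Real.exp (2 * s * (θ' - θ)))
      atTop atTop := by
    refine Tendsto.const_mul_atTop (mul_pos (by linarith) (by linarith)) ?_
    exact Real.tendsto_exp_atTop.comp
      ((tendsto_id.const_mul_atTop two_pos).atTop_mul_const (sub_pos.2 hθθ'))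
  filter_upwards [hlim.eventually_ge_atTop D₀, eventually_ge_atTop 0] with s hs hs0
  set D := ∫ x in (0:ℝ)..1, Real.exp (2 * s * m x) * ψ x ^ 2 with hDdef
  have hDlow : (v - u) * Real.exp (2 * s * θ') ≤ D := by
    have h1 : ∫ x in u..v, Real.exp (2 * s * m x) * ψ x ^ 2 ≤ D :=
      intervalIntegral.integral_mono_interval hu huv.le hv
        (Eventually.of_forall fun t => by positivity)
        (Continuous.intervalIntegrable (by fun_prop) _ _)
    refine le_trans ?_ h1
    rw [← smul_eq_mul, ← intervalIntegral.integral_const]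
    refine intervalIntegral.integral_mono_on huv.le (continuous_const.intervalIntegrable _ _)
      (Continuous.intervalIntegrable (by fun_prop) _ _) fun x hx => ?_
    have hx' : |x - a| ≤ ρ := abs_le.2 ⟨by linarith [hx.1], by linarith [hx.2]⟩
    rw [hψ1 x (hx'.trans hρr), one_pow, mul_one]
    have := hmρ x hx'
    gcongr
  have hDpos : 0 < D := lt_of_lt_of_le (mul_pos (sub_pos.2 huv) (Real.exp_pos _)) hDlow
  refine (lambdaN_le_div hm hc hψ hDpos).trans_lt ?_
  rw [div_lt_iff₀ hDpos]
  have hN : (∫ x in (0:ℝ)..1, Real.exp (2 * s * m x) * (deriv ψ x ^ 2 + c x * ψ x ^ 2))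
      ≤ ∫ x in (0:ℝ)..1, (D₀ * Real.exp (2 * s * θ) + L₁ * (Real.exp (2 * s * m x) * ψ x ^ 2)) := by
    refine intervalIntegral.integral_mono_on zero_le_one
      (Continuous.intervalIntegrable (by fun_prop) _ _)
      (Continuous.intervalIntegrable (by fun_prop) _ _) fun x hx => ?_
    have h1 : Real.exp (2 * s * m x) * deriv ψ x ^ 2 ≤ D₀ * Real.exp (2 * s * θ) := by
      have hb : deriv ψ x ^ 2 ≤ D₀ := (le_abs_self _).trans (hD₀ x hx)
      have hb0 : 0 ≤ D₀ := (sq_nonneg _).trans hb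
      rcases lt_or_ge (|x - a|) (r / 2) with h | h
      · rw [hd1 x h]; simp only [ne_eq, OfNat.ofNat_ne_zero, not_false_eq_true, zero_pow, mul_zero]
        positivity
      rcases lt_or_ge r (|x - a|) with h' | h'
      · rw [hd0 x h']; simp only [ne_eq, OfNat.ofNat_ne_zero, not_false_eq_true, zero_pow, mul_zero]
        positivity
      rw [mul_comm]
      have := hmθ x hx h h'
      gcongr
    have h2 : c x * ψ x ^ 2 ≤ L₁ * ψ x ^ 2 := by
      rcases le_total (|x - a|) r with h | h
      · exact mul_le_mul_of_nonneg_right (hrc x h) (sq_nonneg _)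
      · simp [hψ0 x h]
    have h3 := mul_le_mul_of_nonneg_left h2 (Real.exp_pos (2 * s * m x)).le
    linarith
  rw [intervalIntegral.integral_add (continuous_const.intervalIntegrable _ _)
    (Continuous.intervalIntegrable (by fun_prop) _ _), intervalIntegral.integral_const,
    intervalIntegral.integral_const_mul, ← hDdef, sub_zero, one_smul] at hN
  have h4 : D₀ * Real.exp (2 * s * θ) ≤ (L₂ - L₁) * D := by
    calc D₀ * Real.exp (2 * s * θ)
        ≤ (L₂ - L₁) * (v - u) * Real.exp (2 * s * (θ' - θ)) * Real.exp (2 * s * θ) := by gcongr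
      _ = (L₂ - L₁) * ((v - u) * Real.exp (2 * s * θ')) := by
        rw [mul_assoc, ← Real.exp_add, mul_assoc]; ring_nf
      _ ≤ _ := mul_le_mul_of_nonneg_left hDlow (by linarith)
  have h5 := mul_lt_mul_of_pos_right hL₂ hDpos
  linarith

/-- If `m` attains its maximum on the support of `g` exactly on `[a, b]`, the weights
`exp (2 s (m - m a))` converge to the indicator of `[a, b]` when tested against `g`. -/
theorem tendsto_integral_exp_plateau {m g : ℝ → ℝ} (hm : Continuous m) (hg : Continuous g)
    {a b : ℝ} (ha : 0 ≤ a) (hab : a ≤ b) (hb : b ≤ 1) (hconst : ∀ x ∈ Icc a b, m x = m a)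
    (hlt : ∀ x, x ∉ Icc a b → g x = 0 ∨ m x < m a) :
    Tendsto (fun s : ℝ => ∫ x in (0:ℝ)..1, Real.exp (2 * s * (m x - m a)) * g x) atTop
      (nhds (∫ x in a..b, g x)) := by
  have hlim : ∫ x in a..b, g x = ∫ x in (0:ℝ)..1, (Icc a b).indicator g x := by
    rw [intervalIntegral.integral_of_le hab, intervalIntegral.integral_of_le zero_le_one,
      ← integral_Icc_eq_integral_Ioc, ← integral_Icc_eq_integral_Ioc,
      setIntegral_indicator measurableSet_Icc,
      inter_eq_self_of_subset_right (Icc_subset_Icc ha hb)]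
  rw [hlim]
  refine intervalIntegral.tendsto_integral_filter_of_dominated_convergence (fun x => |g x|)
    ?_ ?_ ?_ ?_
  · exact Eventually.of_forall fun s => Continuous.aestronglyMeasurable (by fun_prop)
  · filter_upwards [eventually_ge_atTop 0] with s hs
    refine Eventually.of_forall fun x _ => ?_
    rw [norm_mul, Real.norm_eq_abs, Real.norm_eq_abs, Real.abs_exp]
    by_cases hx : x ∈ Icc a b
    · simp [hconst x hx]
    rcases hlt x hx with h | h
    · simp [h]
    · refine mul_le_of_le_one_left (abs_nonneg _) (Real.exp_le_one_iff.2 ?_)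
      nlinarith
  · exact Continuous.intervalIntegrable (by fun_prop) _ _
  · refine Eventually.of_forall fun x _ => ?_
    by_cases hx : x ∈ Icc a b
    · simp [hconst x hx, hx]
    rw [indicator_of_notMem hx]
    rcases hlt x hx with h | h
    · simp [h]
    · have : Tendsto (fun s : ℝ => Real.exp (2 * s * (m x - m a))) atTop (nhds 0) :=
        Real.tendsto_exp_atBot.comp
          ((tendsto_id.const_mul_atTop two_pos).atTop_mul_const_of_neg (sub_neg.2 h))
      simpa using this.mul_const (g x)

/-- An isolated maximal plateau `[a, b]` of `m` bounds the eigenvalue asymptotically by the Neumann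
eigenvalue of `[a, b]`. -/
theorem eventually_lambdaN_lt_of_plateau {m c : ℝ → ℝ} (hm : Continuous m) (hc : Continuous c)
    {a b δ L : ℝ} (ha : 0 ≤ a) (hab : a < b) (hb : b ≤ 1) (hδ : 0 < δ)
    (hconst : ∀ x ∈ Icc a b, m x = m a) (hleft : ∀ x ∈ Ico (a - δ) a, m x < m a)
    (hright : ∀ x ∈ Ioc b (b + δ), m x < m a) (hL : lambdaIJ c false false a b < L) :
    ∀ᶠ s in atTop, lambdaN m c s < L := by
  obtain ⟨_, ⟨φ, hφ, -, -, hφ1, rfl⟩, hφL⟩ := exists_lt_of_csInf_lt (lambdaIJ_nonempty c hab) hL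
  let χ : ContDiffBump ((a + b) / 2) := ⟨(b - a) / 2, (b - a) / 2 + δ, by linarith, by linarith⟩
  set ψ : ℝ → ℝ := fun x => χ x * φ x with hψdef
  have hψ : ContDiff ℝ 1 ψ := χ.contDiff.mul hφ
  have hψc : Continuous ψ := hψ.continuous
  have hd : Continuous (deriv ψ) := hψ.continuous_deriv le_rfl
  have hψφ : ∀ x ∈ Icc a b, ψ x = φ x := fun x hx => by
    have : χ x = 1 := χ.one_of_mem_closedBall (by
      rw [Metric.mem_closedBall, Real.dist_eq]
      change _ ≤ (b - a) / 2
      exact abs_le.2 ⟨by linarith [hx.1], by linarith [hx.2]⟩)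
    simp [hψdef, this]
  have hdψφ : ∀ x ∈ Ioo a b, deriv ψ x = deriv φ x := fun x hx =>
    EventuallyEq.deriv_eq (by
      filter_upwards [isOpen_Ioo.mem_nhds hx] with y hy using hψφ y (Ioo_subset_Icc_self hy))
  have hψ0 : ∀ x, x ∉ Icc (a - δ) (b + δ) → ψ x = 0 := fun x hx => by
    have : χ x = 0 := χ.zero_of_le_dist (by
      change (b - a) / 2 + δ ≤ _
      rw [Real.dist_eq, le_abs]
      rw [mem_Icc, not_and_or, not_le, not_le] at hx
      rcases hx with h | h
      · right; linarith
      · left; linarith)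
    simp [hψdef, this]
  have hdψ0 : ∀ x, x ∉ Icc (a - δ) (b + δ) → deriv ψ x = 0 := fun x hx => by
    have : ψ =ᶠ[nhds x] fun _ => 0 := by
      filter_upwards [isClosed_Icc.isOpen_compl.mem_nhds hx] with y hy using hψ0 y hy
    rw [this.deriv_eq, deriv_const]
  have hlt : ∀ x, x ∉ Icc a b → (ψ x = 0 ∧ deriv ψ x = 0) ∨ m x < m a := by
    intro x hx
    by_cases hx' : x ∈ Icc (a - δ) (b + δ)
    · right
      rcases lt_or_ge x a with h | h
      · exact hleft x ⟨hx'.1, h⟩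
      · exact hright x ⟨not_le.1 fun h' => hx ⟨h, h'⟩, hx'.2⟩
    · exact Or.inl ⟨hψ0 x hx', hdψ0 x hx'⟩
  have hD := tendsto_integral_exp_plateau hm (g := fun x => ψ x ^ 2) (by fun_prop) ha hab.le hb
    hconst (fun x hx => (hlt x hx).imp_left fun h => by simp [h.1])
  have hN := tendsto_integral_exp_plateau hm (g := fun x => deriv ψ x ^ 2 + c x * ψ x ^ 2)
    (by fun_prop) ha hab.le hb hconst
    (fun x hx => (hlt x hx).imp_left fun h => by simp [h.1, h.2])
  have hD1 : ∫ x in a..b, ψ x ^ 2 = 1 := by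
    rw [← hφ1]
    refine intervalIntegral.integral_congr fun x hx => ?_
    rw [uIcc_of_le hab.le] at hx
    simp only [hψφ x hx]
  have hN1 : ∫ x in a..b, (deriv ψ x ^ 2 + c x * ψ x ^ 2)
      = ∫ x in a..b, (deriv φ x ^ 2 + c x * φ x ^ 2) := by
    rw [intervalIntegral.integral_of_le hab.le, intervalIntegral.integral_of_le hab.le,
      integral_Ioc_eq_integral_Ioo, integral_Ioc_eq_integral_Ioo]
    refine setIntegral_congr_fun measurableSet_Ioo fun x hx => ?_
    simp only [hψφ x (Ioo_subset_Icc_self hx), hdψφ x hx]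
  rw [hD1] at hD
  rw [hN1] at hN
  have hquot := hN.div hD one_ne_zero
  rw [div_one] at hquot
  filter_upwards [hquot.eventually (gt_mem_nhds hφL), hD.eventually (lt_mem_nhds one_pos)]
    with s hs hDs
  have hscale : ∀ g : ℝ → ℝ, ∫ x in (0:ℝ)..1, Real.exp (2 * s * m x) * g x
      = Real.exp (2 * s * m a) * ∫ x in (0:ℝ)..1, Real.exp (2 * s * (m x - m a)) * g x := by
    intro g
    rw [← intervalIntegral.integral_const_mul]
    congr 1 with x
    rw [← mul_assoc, ← Real.exp_add]
    ring_nf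
  have hpos : 0 < ∫ x in (0:ℝ)..1, Real.exp (2 * s * m x) * ψ x ^ 2 := by
    rw [hscale fun x => ψ x ^ 2]
    exact mul_pos (Real.exp_pos _) hDs
  refine (lambdaN_le_div hm hc hψ hpos).trans_lt ?_
  rwa [hscale fun x => ψ x ^ 2, hscale fun x => deriv ψ x ^ 2 + c x * ψ x ^ 2,
    mul_div_mul_left _ _ (Real.exp_pos _).ne']

theorem kinetic_le {m c φ : ℝ → ℝ} (hm : Continuous m) (hc : Continuous c) (hφ : ContDiff ℝ 1 φ)
    {s K : ℝ} (hK : ∀ x ∈ Icc (0:ℝ) 1, |c x| ≤ K) :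
    (∫ x in (0:ℝ)..1, Real.exp (2 * s * m x) * deriv φ x ^ 2) ≤
      (∫ x in (0:ℝ)..1, Real.exp (2 * s * m x) * (deriv φ x ^ 2 + c x * φ x ^ 2))
        + K * ∫ x in (0:ℝ)..1, Real.exp (2 * s * m x) * φ x ^ 2 := by
  have hd : Continuous (deriv φ) := hφ.continuous_deriv le_rfl
  have hφc := hφ.continuous
  rw [← intervalIntegral.integral_const_mul,
    ← intervalIntegral.integral_add (Continuous.intervalIntegrable (by fun_prop) _ _)
      (Continuous.intervalIntegrable (by fun_prop) _ _)]
  refine intervalIntegral.integral_mono_on zero_le_one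
    (Continuous.intervalIntegrable (by fun_prop) _ _)
    (Continuous.intervalIntegrable (by fun_prop) _ _) fun x hx => ?_
  have h2 := (abs_le.1 (hK x hx)).1
  have h3 : 0 ≤ Real.exp (2 * s * m x) * φ x ^ 2 := by positivity
  nlinarith

theorem neumann_energy_nonneg {m c φ : ℝ → ℝ} (hc : Continuous c)
    (hφ : ContDiff ℝ 1 φ) {a b μ : ℝ} (hab : a ≤ b) (hconst : ∀ x ∈ Icc a b, m x = m a)
    (hμ : μ ≤ lambdaIJ c false false a b) (s : ℝ) :
    0 ≤ ∫ x in a..b, Real.exp (2 * s * m x) * (deriv φ x ^ 2 + (c x - μ) * φ x ^ 2) := by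
  have hd : Continuous (deriv φ) := hφ.continuous_deriv le_rfl
  have hφc := hφ.continuous
  have h1 : ∫ x in a..b, Real.exp (2 * s * m x) * (deriv φ x ^ 2 + (c x - μ) * φ x ^ 2)
      = ∫ x in a..b, Real.exp (2 * s * m a) *
        (deriv φ x ^ 2 + c x * φ x ^ 2 - μ * φ x ^ 2) := by
    refine intervalIntegral.integral_congr fun x hx => ?_
    rw [uIcc_of_le hab] at hx
    simp only [hconst x hx]
    ring
  rw [h1, intervalIntegral.integral_const_mul, intervalIntegral.integral_sub
    (Continuous.intervalIntegrable (by fun_prop) _ _)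
    (Continuous.intervalIntegrable (by fun_prop) _ _), intervalIntegral.integral_const_mul]
  have h2 := lambdaIJ_mul_le hc hφ hab
  have h3 : 0 ≤ ∫ x in a..b, φ x ^ 2 :=
    intervalIntegral.integral_nonneg hab fun _ _ => sq_nonneg _
  have h4 := mul_le_mul_of_nonneg_right hμ h3
  exact mul_nonneg (Real.exp_pos _).le (by linarith)

set_option maxHeartbeats 1000000 in
/-- Asymptotic lower bound: energy-bounded functions concentrate near the maximum points `a₁`, `1`
and the plateau `[a₃, a₄]`. -/
theorem eventually_sub_le_lambdaN {m c : ℝ → ℝ} (hm : Continuous m) (hc : Continuous c)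
    {a₁ a₂ a₃ a₄ a₅ μ ε : ℝ}
    (h0 : 0 < a₁) (h12 : a₁ < a₂) (h23 : a₂ < a₃) (h34 : a₃ < a₄) (h45 : a₄ < a₅)
    (h51 : a₅ < 1)
    (hi₁ : StrictMonoOn m (Icc (0:ℝ) a₁))
    (hi₂ : StrictMonoOn m (Icc a₂ a₃))
    (hi₃ : StrictMonoOn m (Icc a₅ 1))
    (hd₁ : StrictAntiOn m (Icc a₁ a₂))
    (hd₂ : StrictAntiOn m (Icc a₄ a₅))
    (hconst : ∀ x ∈ Icc a₃ a₄, m x = m a₃)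
    (hμ₁ : μ ≤ c a₁) (hμ₂ : μ ≤ c 1) (hμ₃ : μ ≤ lambdaIJ c false false a₃ a₄) (hε : 0 < ε) :
    ∀ᶠ s in atTop, μ - ε ≤ lambdaN m c s := by
  obtain ⟨K, hK0, hKc, hKμ⟩ : ∃ K, 0 < K ∧ (∀ x ∈ Icc (0:ℝ) 1, |c x| ≤ K) ∧ |μ| ≤ K := by
    obtain ⟨K, hK⟩ := exists_abs_le hc 0 1
    refine ⟨|K| + |μ| + 1, by positivity, fun x hx => ?_, ?_⟩
    · linarith [hK x hx, le_abs_self K, abs_nonneg μ]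
    · linarith [abs_nonneg K]
  set M := 2 / (a₄ - a₃) + 4 * K with hM
  have hM0 : 0 < M := by
    have := sub_pos.2 h34
    positivity
  obtain ⟨δ, hδ, hδ₁, hδ₃, hδ₄, hδM, hc₁, hc₂⟩ : ∃ δ, 0 < δ ∧ δ ≤ a₁ ∧ δ ≤ a₃ - a₂ ∧ δ ≤ a₅ - a₄ ∧
      2 * K * M * δ ≤ ε / 8 ∧ (∀ x, |x - a₁| ≤ δ → μ - ε / 2 ≤ c x) ∧
      (∀ x, |x - 1| ≤ δ → μ - ε / 2 ≤ c x) := by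
    have hnear : ∀ a, μ ≤ c a → ∃ r > 0, ∀ x, |x - a| < r → μ - ε / 2 ≤ c x := by
      intro a ha
      obtain ⟨r, hr, h⟩ := Metric.eventually_nhds_iff_ball.1
        (hc.continuousAt.eventually (lt_mem_nhds (by linarith) : ∀ᶠ y in nhds (c a), μ - ε / 2 < y))
      exact ⟨r, hr, fun x hx => (h x (by rwa [Metric.mem_ball, Real.dist_eq])).le⟩
    obtain ⟨r₁, hr₁, h₁⟩ := hnear a₁ hμ₁
    obtain ⟨r₂, hr₂, h₂⟩ := hnear 1 hμ₂
    have e : ∀ᶠ δ in nhdsWithin (0:ℝ) (Ioi 0), δ < a₁ ∧ δ < a₃ - a₂ ∧ δ < a₅ - a₄ ∧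
        δ < ε / 8 / (2 * K * M) ∧ δ < r₁ ∧ δ < r₂ ∧ 0 < δ := by
      have hlt : ∀ y : ℝ, 0 < y → ∀ᶠ δ in nhdsWithin (0:ℝ) (Ioi 0), δ < y := fun y hy =>
        (gt_mem_nhds hy).filter_mono nhdsWithin_le_nhds
      exact (hlt _ h0).and <| (hlt _ (sub_pos.2 h23)).and <| (hlt _ (sub_pos.2 h45)).and <|
        (hlt _ (by positivity)).and <| (hlt _ hr₁).and <| (hlt _ hr₂).and self_mem_nhdsWithin
    obtain ⟨δ, e1, e2, e3, e4, e5, e6, e7⟩ := e.exists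
    refine ⟨δ, e7, e1.le, e2.le, e3.le, ?_, fun x hx => h₁ x (hx.trans_lt e5),
      fun x hx => h₂ x (hx.trans_lt e6)⟩
    rw [lt_div_iff₀ (by positivity)] at e4
    linarith
  have hB : 0 ≤ 2 * K := by positivity
  have hε' : 0 < ε / 4 / (2 * K) := by positivity
  filter_upwards [decay_of_strictMonoOn hm le_rfl (by linarith) hi₁ hδ hB hε',
    decay_of_strictAntiOn hm h0.le (by linarith) hd₁ hδ hB hε',
    decay_of_strictMonoOn hm (by linarith) (by linarith) hi₂ hδ hB hε',
    decay_of_strictAntiOn hm (by linarith) h51.le hd₂ hδ hB hε',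
    decay_of_strictMonoOn hm (by linarith) le_rfl hi₃ hδ hB hε',
    eventually_ge_atTop 0] with s s₁ s₂ s₃ s₄ s₅ hs
  refine le_lambdaN hm fun φ hφ hW => ?_
  have hd : Continuous (deriv φ) := hφ.continuous_deriv le_rfl
  have hφc := hφ.continuous
  set E := ∫ x in (0:ℝ)..1, Real.exp (2 * s * m x) * (deriv φ x ^ 2 + c x * φ x ^ 2) with hE
  by_contra! hlt
  have hP : (∫ t in (0:ℝ)..1, Real.exp (2 * s * m t) * deriv φ t ^ 2) ≤ 2 * K := by
    have h1 := kinetic_le hm hc hφ (s := s) hKc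
    rw [hW, ← hE] at h1
    linarith [le_abs_self μ]
  have hcμ : ∀ x ∈ Icc (0:ℝ) 1, -(2 * K) ≤ c x - μ := fun x hx => by
    linarith [(abs_le.1 (hKc x hx)).1, (abs_le.1 hKμ).2]
  set h : ℝ → ℝ := fun x => Real.exp (2 * s * m x) * (deriv φ x ^ 2 + (c x - μ) * φ x ^ 2)
    + (ε / 2) * (Real.exp (2 * s * m x) * φ x ^ 2) + ε / 4 with hh
  have hcont : Continuous h := by fun_prop
  have htotal : ∫ x in (0:ℝ)..1, h x = E - μ + ε / 2 + ε / 4 := by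
    have : ∀ x, h x = Real.exp (2 * s * m x) * (deriv φ x ^ 2 + c x * φ x ^ 2)
        + (ε / 2 - μ) * (Real.exp (2 * s * m x) * φ x ^ 2) + ε / 4 := fun x => by
      simp only [hh]; ring
    simp_rw [this]
    rw [intervalIntegral.integral_add (Continuous.intervalIntegrable (by fun_prop) _ _)
      (continuous_const.intervalIntegrable _ _),
      intervalIntegral.integral_add (Continuous.intervalIntegrable (by fun_prop) _ _)
      (Continuous.intervalIntegrable (by fun_prop) _ _), intervalIntegral.integral_const_mul,
      hW, ← hE, intervalIntegral.integral_const]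
    simp only [sub_zero, one_smul]
    ring
  have hgeneral : ∀ x ∈ Icc (0:ℝ) 1,
      -(2 * K) * (Real.exp (2 * s * m x) * φ x ^ 2) + ε / 4 ≤ h x := fun x hx => by
    have h3 : 0 ≤ Real.exp (2 * s * m x) * φ x ^ 2 := by positivity
    have h4 : 0 ≤ Real.exp (2 * s * m x) * deriv φ x ^ 2 := by positivity
    simp only [hh]
    nlinarith [hcμ x hx]
  have hgood : ∀ x ∈ Icc (0:ℝ) 1, (μ - ε / 2 ≤ c x ∨
      Real.exp (2 * s * m x) * φ x ^ 2 ≤ ε / 4 / (2 * K)) → 0 ≤ h x := by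
    rintro x hx (h1 | h1)
    · have h3 : 0 ≤ Real.exp (2 * s * m x) * φ x ^ 2 := by positivity
      have h4 : 0 ≤ Real.exp (2 * s * m x) * deriv φ x ^ 2 := by positivity
      simp only [hh]
      nlinarith
    · rw [le_div_iff₀ (by positivity)] at h1
      linarith [hgeneral x hx]
  have hleft : ∀ x ∈ Icc 0 (a₃ - δ), 0 ≤ h x := fun x hx => by
    refine hgood x ⟨hx.1, by linarith [hx.2]⟩ ?_
    rcases le_total x (a₁ - δ) with h1 | h1
    · exact Or.inr (s₁ φ hφ hW hP x ⟨hx.1, h1⟩)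
    rcases le_total x (a₁ + δ) with h2 | h2
    · exact Or.inl (hc₁ x (abs_le.2 ⟨by linarith, by linarith⟩))
    rcases le_total x a₂ with h3 | h3
    · exact Or.inr (s₂ φ hφ hW hP x ⟨h2, h3⟩)
    · exact Or.inr (s₃ φ hφ hW hP x ⟨h3, hx.2⟩)
  have hright : ∀ x ∈ Icc (a₄ + δ) 1, 0 ≤ h x := fun x hx => by
    refine hgood x ⟨by linarith [hx.1], hx.2⟩ ?_
    rcases le_total x a₅ with h1 | h1
    · exact Or.inr (s₄ φ hφ hW hP x ⟨hx.1, h1⟩)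
    rcases le_total x (1 - δ) with h2 | h2
    · exact Or.inr (s₅ φ hφ hW hP x ⟨h1, h2⟩)
    · exact Or.inl (hc₂ x (abs_le.2 ⟨by linarith, by linarith [hx.2]⟩))
  have hm₃ : ∀ x ∈ Icc a₂ a₃, m x ≤ m a₃ := fun x hx =>
    hi₂.monotoneOn hx ⟨h23.le, le_rfl⟩ hx.2
  have hm₄ : ∀ x ∈ Icc a₄ a₅, m x ≤ m a₃ := fun x hx =>
    (hd₂.antitoneOn ⟨le_rfl, h45.le⟩ hx hx.1).trans_eq (hconst a₄ ⟨h34.le, le_rfl⟩)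
  have hbound : ∀ p q x : ℝ, 0 ≤ p → q ≤ 1 → p ≤ a₃ → a₄ ≤ q → x ∈ Icc p q →
      (∀ t ∈ Icc p q, m x ≤ m t) → Real.exp (2 * s * m x) * φ x ^ 2 ≤ M := by
    intro p q x hp hq hp3 hq4 hx hmx
    have := weighted_sq_le (η := 0) hm hφ hs hp hq hp3 h34 hq4 hx hmx
      (fun t ht => by simpa using hmx t ⟨hp3.trans ht.1, ht.2.trans hq4⟩)
    rw [hW, mul_zero, neg_zero, Real.exp_zero, mul_one, mul_one] at this
    have h2 : 2 * (q - p) * (∫ t in (0:ℝ)..1, Real.exp (2 * s * m t) * deriv φ t ^ 2)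
        ≤ 2 * (2 * K) :=
      mul_le_mul (by linarith) hP (intervalIntegral.integral_nonneg zero_le_one
        fun t _ => by positivity) zero_le_two
    linarith
  have hbound₃ : ∀ x ∈ Icc (a₃ - δ) a₃, -(2 * K * M) ≤ h x := fun x hx => by
    have hx2 : a₂ ≤ x := by linarith [hx.1]
    have := hbound x a₄ x (by linarith) (by linarith) hx.2 le_rfl
      ⟨le_rfl, by linarith [hx.2]⟩ fun t ht => by
        rcases le_total t a₃ with h1 | h1
        · exact hi₂.monotoneOn ⟨hx2, hx.2⟩ ⟨hx2.trans ht.1, h1⟩ ht.1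
        · exact (hm₃ x ⟨hx2, hx.2⟩).trans_eq (hconst t ⟨h1, ht.2⟩).symm
    have h3 := hgeneral x ⟨by linarith, by linarith [hx.2]⟩
    nlinarith
  have hbound₄ : ∀ x ∈ Icc a₄ (a₄ + δ), -(2 * K * M) ≤ h x := fun x hx => by
    have hx5 : x ≤ a₅ := by linarith [hx.2]
    have := hbound a₃ x x (by linarith) (by linarith) le_rfl hx.1
      ⟨by linarith [hx.1], le_rfl⟩ fun t ht => by
        rcases le_total t a₄ with h1 | h1
        · exact (hm₄ x ⟨hx.1, hx5⟩).trans_eq (hconst t ⟨ht.1, h1⟩).symm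
        · exact hd₂.antitoneOn ⟨h1, ht.2.trans hx5⟩ ⟨hx.1, hx5⟩ ht.2
    have h3 := hgeneral x ⟨by linarith [hx.1], by linarith⟩
    nlinarith
  have hthin : ∀ a : ℝ, (∀ x ∈ Icc a (a + δ), -(2 * K * M) ≤ h x) →
      -(ε / 8) ≤ ∫ x in a..a + δ, h x := by
    intro a ha
    have := intervalIntegral.integral_mono_on (μ := volume) (by linarith : a ≤ a + δ)
      (continuous_const.intervalIntegrable _ _) (hcont.intervalIntegrable _ _) ha
    rw [intervalIntegral.integral_const, smul_eq_mul] at this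
    linarith
  have hint : ∀ a b, IntervalIntegrable h volume a b := hcont.intervalIntegrable
  have I₁ : 0 ≤ ∫ x in (0:ℝ)..(a₃ - δ), h x :=
    intervalIntegral.integral_nonneg (by linarith) hleft
  have I₂ : -(ε / 8) ≤ ∫ x in (a₃ - δ)..a₃, h x := by
    have := hthin (a₃ - δ)
    rw [sub_add_cancel] at this
    exact this hbound₃
  have I₃ : 0 ≤ ∫ x in a₃..a₄, h x := by
    refine (neumann_energy_nonneg hc hφ h34.le hconst hμ₃ s).trans ?_
    refine intervalIntegral.integral_mono_on h34.le
      (Continuous.intervalIntegrable (by fun_prop) _ _) (hint _ _) fun x _ => ?_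
    have : 0 ≤ ε / 2 * (Real.exp (2 * s * m x) * φ x ^ 2) := by positivity
    simp only [hh]
    linarith
  have I₄ := hthin a₄ hbound₄
  have I₅ : 0 ≤ ∫ x in (a₄ + δ)..1, h x :=
    intervalIntegral.integral_nonneg (by linarith) hright
  have hsplit : ∫ x in (0:ℝ)..1, h x = (∫ x in (0:ℝ)..(a₃ - δ), h x) + (∫ x in (a₃ - δ)..a₃, h x)
      + (∫ x in a₃..a₄, h x) + (∫ x in a₄..(a₄ + δ), h x) + ∫ x in (a₄ + δ)..1, h x := by
    rw [intervalIntegral.integral_add_adjacent_intervals (hint _ _) (hint _ _),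
      intervalIntegral.integral_add_adjacent_intervals (hint _ _) (hint _ _),
      intervalIntegral.integral_add_adjacent_intervals (hint _ _) (hint _ _),
      intervalIntegral.integral_add_adjacent_intervals (hint _ _) (hint _ _)]
  linarith

/-- Theorem 2.1: with `m` as in (T1),
`lim_{s→∞} λ₁ᴺ(s) = min{c(a₁), c(1), λ₁ᴺᴺ(a₃,a₄)}`. -/
theorem lambdaN_tendsto_of_T1
    (m c : ℝ → ℝ) (hm : ContDiff ℝ 2 m) (hc : Continuous c)
    (a₁ a₂ a₃ a₄ a₅ : ℝ)
    (h0 : 0 < a₁) (h12 : a₁ < a₂) (h23 : a₂ < a₃) (h34 : a₃ < a₄) (h45 : a₄ < a₅)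
    (h51 : a₅ < 1)
    (hi₁ : StrictMonoOn m (Set.Icc (0:ℝ) a₁))
    (hi₂ : StrictMonoOn m (Set.Icc a₂ a₃))
    (hi₃ : StrictMonoOn m (Set.Icc a₅ 1))
    (hd₁ : StrictAntiOn m (Set.Icc a₁ a₂))
    (hd₂ : StrictAntiOn m (Set.Icc a₄ a₅))
    (hconst : ∀ x ∈ Set.Icc a₃ a₄, m x = m a₃) :
    Tendsto (lambdaN m c) Filter.atTop
      (nhds (min (c a₁) (min (c 1) (lambdaIJ c false false a₃ a₄)))) := by
  have hmc := hm.continuous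
  refine tendsto_order.2 ⟨fun L hL => ?_, fun L hL => ?_⟩
  · filter_upwards [eventually_sub_le_lambdaN hmc hc h0 h12 h23 h34 h45 h51 hi₁ hi₂ hi₃ hd₁ hd₂
      hconst (min_le_left _ _) ((min_le_right _ _).trans (min_le_left _ _))
      ((min_le_right _ _).trans (min_le_right _ _)) (half_pos (sub_pos.2 hL))] with s hs
    linarith
  · rcases min_lt_iff.1 hL with hL | hL
    · refine eventually_lambdaN_lt_of_peak hmc hc (δ := a₂ - a₁) ⟨h0.le, by linarith⟩ (by linarith)
        (fun x hx hxa hxδ => ?_) hL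
      rcases lt_or_gt_of_ne hxa with h | h
      · exact hi₁ ⟨hx.1, h.le⟩ ⟨h0.le, le_rfl⟩ h
      · exact hd₁ ⟨le_rfl, h12.le⟩ ⟨h.le, by linarith [(abs_le.1 hxδ).2]⟩ h
    rcases min_lt_iff.1 hL with hL | hL
    · refine eventually_lambdaN_lt_of_peak hmc hc (δ := 1 - a₅) ⟨zero_le_one, le_rfl⟩ (by linarith)
        (fun x hx hxa hxδ => ?_) hL
      exact hi₃ ⟨by linarith [(abs_le.1 hxδ).1], hx.2⟩ ⟨h51.le, le_rfl⟩ (lt_of_le_of_ne hx.2 hxa)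
    · refine eventually_lambdaN_lt_of_plateau hmc hc (δ := min (a₃ - a₂) (a₅ - a₄)) (by linarith)
        h34 (by linarith) (lt_min (by linarith) (by linarith)) hconst (fun x hx => ?_)
        (fun x hx => ?_) hL
      · exact hi₂ ⟨by linarith [hx.1, min_le_left (a₃ - a₂) (a₅ - a₄)], hx.2.le⟩ ⟨h23.le, le_rfl⟩
          hx.2
      · rw [← hconst a₄ ⟨h34.le, le_rfl⟩]
        exact hd₂ ⟨le_rfl, h45.le⟩
          ⟨hx.1.le, by linarith [hx.2, min_le_right (a₃ - a₂) (a₅ - a₄)]⟩ hx.1
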